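/- arXiv:2412.14811 — 3 statements merged into one kernel-verified Lean document; each statement's English description precedes it below -/
import Mathlib

section
/- Let N ≥ 3 be odd, q ∈ ℂ a primitive N-th root of unity, and let X, Z be invertible N×N complex matrices with Z·X = q·X·Z and X^N = Z^N = 1. Let x_r, y_r, μ_r, x_s, y_s, μ_s ∈ ℂ and suppose Ŵ : ZMod N → ℂ satisfies (μ_s x_s − μ_r x_r q^{2n})·Ŵ(n) = (μ_s y_r − μ_r y_s q^{2(n−1)})·Ŵ(n−1) for every n ∈ ZMod N. Set χ := X⁻¹ ⊗ X and S := ∑_{n=0}^{N-1} Ŵ(n) χ^n (N²×N² matrices). Then μ_r·S·(Z² ⊗ 1)·(x_r·1 − y_s·χ) = μ_s·(Z² ⊗ 1)·(x_s·1 − y_r·χ)·S. -/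
open Matrix Kronecker

/-- Powers of an element of order dividing `N`, indexed by residues modulo `N`, shift under
multiplication by that element. -/
theorem pow_val_sub_one_mul {M : Type*} [Monoid M] {N : ℕ} [NeZero N] {c : M} (hc : c ^ N = 1)
    (n : ZMod N) : c ^ (n - 1).val * c = c ^ n.val := by
  have h : n.val = ((n - 1).val + 1) % N := by
    rw [← ZMod.val_natCast, Nat.cast_add, ZMod.natCast_zmod_val, Nat.cast_one, sub_add_cancel]
  rw [h, ← pow_eq_pow_mod _ hc, pow_succ]

theorem pow_mul_of_mul_eq_smul_mul {R A : Type*} [CommSemiring R] [Semiring A] [Algebra R A]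
    {t : R} {c w : A} (h : c * w = t • (w * c)) (k : ℕ) :
    c ^ k * w = t ^ k • (w * c ^ k) := by
  induction k with
  | zero => simp
  | succ k ih =>
    rw [pow_succ, mul_assoc, h, mul_smul_comm, ← mul_assoc, ih, smul_mul_assoc, smul_smul,
      mul_assoc, pow_succ']

/-- A cyclic sum of powers of `c` whose coefficients satisfy a two-term recursion intertwines
two linear polynomials in `c`, up to an element `w` which `t`-commutes with `c`. -/
theorem intertwine_of_recursion {R A : Type*} [CommRing R] [Ring A] [Algebra R A]
    {N : ℕ} [NeZero N] {t : R} {c w : A} (hc : c ^ N = 1) (h : c * w = t • (w * c))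
    {xr yr μr xs ys μs : R} {f : ZMod N → R}
    (hf : ∀ n : ZMod N, (μs * xs - μr * xr * t ^ n.val) * f n
      = (μs * yr - μr * ys * t ^ (n - 1).val) * f (n - 1)) :
    μr • ((∑ n : ZMod N, f n • c ^ n.val) * w * (xr • (1 : A) - ys • c))
      = μs • (w * (xs • (1 : A) - yr • c) * ∑ n : ZMod N, f n • c ^ n.val) := by
  have hshift (g : ZMod N → R) :
      ∑ n, g n • (w * (c ^ n.val * c)) = ∑ n, g (n - 1) • (w * c ^ n.val) := by
    rw [← Equiv.sum_comp (Equiv.subRight (1 : ZMod N))]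
    simp only [Equiv.subRight_apply, pow_val_sub_one_mul hc]
  have hl : μr • ((∑ n : ZMod N, f n • c ^ n.val) * w * (xr • (1 : A) - ys • c))
      = ∑ n, (μr * xr * t ^ n.val * f n) • (w * c ^ n.val)
        - ∑ n, (μr * ys * t ^ n.val * f n) • (w * (c ^ n.val * c)) := by
    simp only [Finset.sum_mul, Finset.smul_sum, ← Finset.sum_sub_distrib, smul_mul_assoc,
      pow_mul_of_mul_eq_smul_mul h, mul_sub, mul_smul_comm, mul_one, mul_assoc]
    refine Finset.sum_congr rfl fun n _ => ?_
    module
  have hr : μs • (w * (xs • (1 : A) - yr • c) * ∑ n : ZMod N, f n • c ^ n.val)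
      = ∑ n, (μs * xs * f n) • (w * c ^ n.val)
        - ∑ n, (μs * yr * f n) • (w * (c ^ n.val * c)) := by
    simp only [Finset.mul_sum, Finset.smul_sum, ← Finset.sum_sub_distrib, smul_mul_assoc,
      mul_sub, sub_mul, mul_smul_comm, mul_one, mul_assoc, ← pow_succ, ← pow_succ']
    refine Finset.sum_congr rfl fun n _ => ?_
    module
  rw [hl, hr, hshift, hshift, ← Finset.sum_sub_distrib, ← Finset.sum_sub_distrib]
  refine Finset.sum_congr rfl fun n _ => ?_
  rw [← sub_smul, ← sub_smul]
  congr 1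
  linear_combination -hf n

/-- The defining intertwining identity (eq:Srscond) for `S_{rs} = ∑ Ŵ_{rs}(n) χⁿ`,
`χ = X⁻¹ ⊗ X`, which follows from the recursion (eq:WRR) for the chiral Potts weights. -/
theorem stmt_4 (N : ℕ) [NeZero N] (hN : 3 ≤ N) (hNodd : Odd N)
    (q : ℂ) (hq : IsPrimitiveRoot q N)
    (X Z : Matrix (Fin N) (Fin N) ℂ) (hXu : IsUnit X) (hZu : IsUnit Z)
    (hZX : Z * X = q • (X * Z)) (hXN : X ^ N = 1) (hZN : Z ^ N = 1)
    (xr yr μr xs ys μs : ℂ) (What : ZMod N → ℂ)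
    (hrec : ∀ n : ZMod N,
      (μs * xs - μr * xr * (q ^ 2) ^ n.val) * What n
        = (μs * yr - μr * ys * (q ^ 2) ^ (n - 1).val) * What (n - 1)) :
    μr • ((∑ n : ZMod N, What n • (X⁻¹ ⊗ₖ X) ^ n.val) *
        ((Z ^ 2) ⊗ₖ (1 : Matrix (Fin N) (Fin N) ℂ)) *
        (xr • (1 : Matrix (Fin N × Fin N) (Fin N × Fin N) ℂ) - ys • (X⁻¹ ⊗ₖ X)))
      = μs • (((Z ^ 2) ⊗ₖ (1 : Matrix (Fin N) (Fin N) ℂ)) *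
        (xs • (1 : Matrix (Fin N × Fin N) (Fin N × Fin N) ℂ) - yr • (X⁻¹ ⊗ₖ X)) *
        (∑ n : ZMod N, What n • (X⁻¹ ⊗ₖ X) ^ n.val)) := by
  have hX : IsUnit X.det := (Matrix.isUnit_iff_isUnit_det X).mp hXu
  have hkron (k : ℕ) : (X⁻¹ ⊗ₖ X) ^ k = (X⁻¹ ^ k) ⊗ₖ (X ^ k) := by
    induction k with
    | zero => simp
    | succ k ih => rw [pow_succ, ih, ← Matrix.mul_kronecker_mul, ← pow_succ, ← pow_succ]
  have hc : (X⁻¹ ⊗ₖ X) ^ N = 1 := by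
    rw [hkron, Matrix.inv_pow', hXN, inv_one, Matrix.one_kronecker_one]
  have hXZ : X⁻¹ * Z = q • (Z * X⁻¹) := by
    calc X⁻¹ * Z = X⁻¹ * (Z * X) * X⁻¹ := by
          rw [← mul_assoc, Matrix.mul_nonsing_inv_cancel_right _ _ hX]
      _ = q • (Z * X⁻¹) := by
          rw [hZX, mul_smul_comm, smul_mul_assoc, Matrix.nonsing_inv_mul_cancel_left _ _ hX]
  have hXZ2 : X⁻¹ * Z ^ 2 = q ^ 2 • (Z ^ 2 * X⁻¹) := by
    rw [pow_two Z, ← mul_assoc, hXZ, smul_mul_assoc, mul_assoc, hXZ, mul_smul_comm, smul_smul,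
      ← mul_assoc, pow_two]
  refine intertwine_of_recursion hc ?_ hrec
  rw [← Matrix.mul_kronecker_mul, ← Matrix.mul_kronecker_mul, hXZ2, mul_one, one_mul,
    Matrix.smul_kronecker]
end

section
/- Let N ≥ 3 be odd, q ∈ ℂ a primitive N-th root of unity, and let X, Z be invertible N×N complex matrices with Z·X = q·X·Z and X^N = Z^N = 1. Let x_r, y_r, μ_r, x_s, y_s, μ_s, κ₀, κ₁, z ∈ ℂ, and suppose W̄ : ZMod N → ℂ satisfies (y_s − y_r q^{2n})·W̄(n) = μ_r μ_s (x_r q² − x_s q^{2n})·W̄(n−1) for every n ∈ ZMod N; set T := ∑_{n=0}^{N-1} W̄(n) Z^{2n}. For 2×2 complex matrices A, B let {A,B} := diag(X⁻¹,1)·A·diag(Z⁻¹,Z)·B·diag(X,1), a 2×2 block matrix with N×N blocks (scalar entries of A, B being read as scalar multiples of the N×N identity), regarded as an element of End(ℂ^N ⊗ ℂ²). Let U_a(z) := [[z, κ₀ x_a μ_a],[κ₁ y_a, z μ_a]] and V_a(z) := [[−qz, κ₀ y_a],[q κ₁ x_a μ_a, −z μ_a]] for a ∈ {r, s}, and set L_{rs}(z)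 := {U_r(z), V_s(z)}, L_{sr}(z) := {U_s(z), V_r(z)}. Then diag(T, T)·L_{rs}(z) = L_{sr}(z)·diag(T, T) as 2×2 block matrices with N×N blocks. -/
open Matrix Kronecker

noncomputable section

/-- `E₀₀`, the elementary 2×2 matrix picking out the first component. -/
def E00 : Matrix (Fin 2) (Fin 2) ℂ := !![1, 0; 0, 0]

/-- `E₁₁`, the elementary 2×2 matrix picking out the second component. -/
def E11 : Matrix (Fin 2) (Fin 2) ℂ := !![0, 0; 0, 1]

/-- The bracket `{A,B} = diag(X⁻¹,1)·A·diag(Z⁻¹,Z)·B·diag(X,1)` of (eq:ABnotn),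
realized as an operator on `ℂ^m ⊗ ℂ²` (scalar entries of `A`, `B` acting as scalars). -/
def bra {m : Type*} [Fintype m] [DecidableEq m] (X Z : Matrix m m ℂ)
    (A B : Matrix (Fin 2) (Fin 2) ℂ) : Matrix (m × Fin 2) (m × Fin 2) ℂ :=
  (X⁻¹ ⊗ₖ E00 + (1 : Matrix m m ℂ) ⊗ₖ E11) * ((1 : Matrix m m ℂ) ⊗ₖ A) *
    (Z⁻¹ ⊗ₖ E00 + Z ⊗ₖ E11) * ((1 : Matrix m m ℂ) ⊗ₖ B) *
    (X ⊗ₖ E00 + (1 : Matrix m m ℂ) ⊗ₖ E11)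

/-- The `2 × 2` block matrix with blocks `P`, `Q`, `R`, `S`, as an operator on `ℂ^m ⊗ ℂ²`. -/
def tensorBlock {m : Type*} (P Q R S : Matrix m m ℂ) : Matrix (m × Fin 2) (m × Fin 2) ℂ :=
  P ⊗ₖ !![1, 0; 0, 0] + Q ⊗ₖ !![0, 1; 0, 0] + R ⊗ₖ !![0, 0; 1, 0] + S ⊗ₖ !![0, 0; 0, 1]

lemma tensorBlock_mul {m : Type*} [Fintype m] (P Q R S P' Q' R' S' : Matrix m m ℂ) :
    tensorBlock P Q R S * tensorBlock P' Q' R' S' =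
      tensorBlock (P * P' + Q * R') (P * Q' + Q * S') (R * P' + S * R') (R * Q' + S * S') := by
  have h0 : (!![0, 0; 0, 0] : Matrix (Fin 2) (Fin 2) ℂ) = 0 := by
    ext i j; fin_cases i <;> fin_cases j <;> rfl
  simp only [tensorBlock, add_mul, mul_add, ← mul_kronecker_mul, Matrix.add_kronecker]
  simp only [mul_fin_two, mul_zero, mul_one, add_zero, zero_add, h0, kronecker_zero]
  abel

lemma one_kronecker_eq_tensorBlock {m : Type*} [DecidableEq m] (a b c d : ℂ) :
    (1 : Matrix m m ℂ) ⊗ₖ !![a, b; c, d] =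
      tensorBlock (a • 1) (b • 1) (c • 1) (d • (1 : Matrix m m ℂ)) := by
  ext ⟨i, k⟩ ⟨j, l⟩
  fin_cases k <;> fin_cases l <;> simp [tensorBlock, mul_comm]

lemma kronecker_one_eq_tensorBlock {m : Type*} (P : Matrix m m ℂ) :
    P ⊗ₖ (1 : Matrix (Fin 2) (Fin 2) ℂ) = tensorBlock P 0 0 P := by
  ext ⟨i, k⟩ ⟨j, l⟩
  fin_cases k <;> fin_cases l <;> simp [tensorBlock]

lemma kronecker_E00_add_kronecker_E11 {m : Type*} (P S : Matrix m m ℂ) :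
    P ⊗ₖ E00 + S ⊗ₖ E11 = tensorBlock P 0 0 S := by
  simp [tensorBlock, E00, E11]

lemma bra_eq_tensorBlock {m : Type*} [Fintype m] [DecidableEq m] (X Z : Matrix m m ℂ)
    (a b c d e f g h : ℂ) :
    bra X Z !![a, b; c, d] !![e, f; g, h] =
      tensorBlock (X⁻¹ * ((a * e) • Z⁻¹ + (b * g) • Z) * X)
        (X⁻¹ * ((a * f) • Z⁻¹ + (b * h) • Z))
        (((c * e) • Z⁻¹ + (d * g) • Z) * X) ((c * f) • Z⁻¹ + (d * h) • Z) := by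
  simp only [bra, kronecker_E00_add_kronecker_E11, one_kronecker_eq_tensorBlock, tensorBlock_mul]
  simp [mul_add, add_mul, smul_smul, mul_comm]

lemma pow_val_add_one {M : Type*} [Monoid M] {N : ℕ} [NeZero N] {a : M} (ha : a ^ N = 1)
    (n : ZMod N) : a ^ (n + 1).val = a * a ^ n.val := by
  rw [← pow_succ']
  refine pow_eq_pow_of_modEq ?_ ha
  rw [← ZMod.natCast_eq_natCast_iff]
  simp

/-- The recursion for `W`, summed against the powers of `Y`. -/
lemma sum_recursion {A : Type*} [Ring A] [Algebra ℂ A] {N : ℕ} [NeZero N] {w : ℂ} (hw : w ^ N = 1)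
    (hw0 : w ≠ 0) {Y : A} (hY : Y ^ N = 1) (W : ZMod N → ℂ) (a b c d : ℂ)
    (hrec : ∀ n : ZMod N, (a - b * w ^ n.val) * W n = (c * w - d * w ^ n.val) * W (n - 1)) :
    (a • (1 : A) - c • Y) * ∑ n : ZMod N, (W n * (w ^ n.val)⁻¹) • Y ^ n.val =
      (b • (1 : A) - d • Y) * ∑ n : ZMod N, W n • Y ^ n.val := by
  have shift (V : ZMod N → ℂ) :
      Y * ∑ n : ZMod N, V n • Y ^ n.val = ∑ n : ZMod N, V (n - 1) • Y ^ n.val := by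
    rw [Finset.mul_sum, ← Equiv.sum_comp (Equiv.addRight (1 : ZMod N)) fun n => V (n - 1) • Y ^ n.val]
    simp [pow_val_add_one hY]
  simp only [sub_mul, smul_mul_assoc, one_mul, shift]
  simp only [Finset.smul_sum, smul_smul, ← Finset.sum_sub_distrib, ← sub_smul]
  refine Finset.sum_congr rfl fun n _ => ?_
  congr 1
  have hn : w ^ n.val = w * w ^ (n - 1).val := by simpa using pow_val_add_one hw (n - 1)
  have hr := hrec n
  have h1 : w ^ (n - 1).val ≠ 0 := pow_ne_zero _ hw0
  rw [hn] at hr ⊢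
  field_simp
  linear_combination hr

/-- Proposition (LLproperties)(i): `(id ⊗ T_{rs})·Ľ_{Ω_{rs}}(z) = Ľ_{Ω_{sr}}(z)·(T_{rs} ⊗ id)`. -/
theorem stmt_10 (N : ℕ) [NeZero N] (hN : 3 ≤ N) (hNodd : Odd N)
    (q : ℂ) (hq : IsPrimitiveRoot q N)
    (X Z : Matrix (Fin N) (Fin N) ℂ) (hXu : IsUnit X) (hZu : IsUnit Z)
    (hZX : Z * X = q • (X * Z)) (hXN : X ^ N = 1) (hZN : Z ^ N = 1)
    (xr yr μr xs ys μs κ₀ κ₁ z : ℂ)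
    (Wbar : ZMod N → ℂ)
    (hrec : ∀ n : ZMod N,
      (ys - yr * (q ^ 2) ^ n.val) * Wbar n
        = μr * μs * (xr * q ^ 2 - xs * (q ^ 2) ^ n.val) * Wbar (n - 1)) :
    ((∑ n : ZMod N, Wbar n • Z ^ (2 * n.val)) ⊗ₖ (1 : Matrix (Fin 2) (Fin 2) ℂ)) *
        bra X Z !![z, κ₀ * xr * μr; κ₁ * yr, z * μr]
          !![-(q * z), κ₀ * ys; q * κ₁ * xs * μs, -(z * μs)]
      = bra X Z !![z, κ₀ * xs * μs; κ₁ * ys, z * μs]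
          !![-(q * z), κ₀ * yr; q * κ₁ * xr * μr, -(z * μr)] *
        ((∑ n : ZMod N, Wbar n • Z ^ (2 * n.val)) ⊗ₖ (1 : Matrix (Fin 2) (Fin 2) ℂ)) := by
  have hq0 : q ≠ 0 := hq.ne_zero (NeZero.ne N)
  have hXd := (Matrix.isUnit_iff_isUnit_det X).mp hXu
  have hZd := (Matrix.isUnit_iff_isUnit_det Z).mp hZu
  have hX1 : X * X⁻¹ = 1 := Matrix.mul_nonsing_inv X hXd
  have hX2 : X⁻¹ * X = 1 := Matrix.nonsing_inv_mul X hXd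
  have hZ1 : Z * Z⁻¹ = 1 := Matrix.mul_nonsing_inv Z hZd
  have hZ2 : Z⁻¹ * Z = 1 := Matrix.nonsing_inv_mul Z hZd
  have hXZ : X⁻¹ * Z * X = q • Z := by
    rw [mul_assoc, hZX, mul_smul_comm, ← mul_assoc, hX2, one_mul]
  have hXZi : X⁻¹ * Z⁻¹ * X = q⁻¹ • Z⁻¹ := by
    have h : X = q • (Z⁻¹ * X * Z) := by
      rw [mul_assoc, ← mul_smul_comm, ← hZX, ← mul_assoc, hZ2, one_mul]
    have h' : Z⁻¹ * X = q⁻¹ • (X * Z⁻¹) := by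
      conv_rhs => rw [h]
      rw [smul_mul_assoc, smul_smul, inv_mul_cancel₀ hq0, one_smul, mul_assoc, hZ1, mul_one]
    rw [mul_assoc, h', mul_smul_comm, ← mul_assoc, hX2, one_mul]
  have hw : (q ^ 2) ^ N = 1 := by rw [← pow_mul, mul_comm, pow_mul, hq.pow_eq_one, one_pow]
  have hY : (Z ^ 2) ^ N = 1 := by rw [← pow_mul, mul_comm, pow_mul, hZN, one_pow]
  simp only [pow_mul]
  set T := ∑ n : ZMod N, Wbar n • (Z ^ 2) ^ n.val with hT
  set T' := ∑ n : ZMod N, (Wbar n * ((q ^ 2) ^ n.val)⁻¹) • (Z ^ 2) ^ n.val with hT'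
  have key := sum_recursion hw (pow_ne_zero 2 hq0) hY Wbar ys yr (μr * μs * xr) (μr * μs * xs)
    (fun n => by rw [hrec n]; ring)
  rw [← hT, ← hT'] at key
  have hTZ : Commute T Z := Commute.sum_left _ _ _ fun n _ =>
    (((Commute.refl Z).pow_left 2).pow_left _).smul_left _
  have hTZi : T * Z⁻¹ = Z⁻¹ * T := by
    rw [← one_mul (T * Z⁻¹), ← hZ2, mul_assoc, ← mul_assoc Z, ← hTZ.eq, mul_assoc T, hZ1, mul_one]
  have hXT : X * T = T' * X := by
    have hpow (k : ℕ) : Z ^ k * X = q ^ k • (X * Z ^ k) := by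
      induction k with
      | zero => simp
      | succ k ih =>
        rw [pow_succ, mul_assoc, hZX, mul_smul_comm, ← mul_assoc, ih, smul_mul_assoc, smul_smul,
          mul_assoc, ← pow_succ']
    rw [hT, hT', Finset.mul_sum, Finset.sum_mul]
    refine Finset.sum_congr rfl fun n _ => ?_
    rw [← pow_mul, ← pow_mul, smul_mul_assoc, hpow, smul_smul, mul_assoc,
      inv_mul_cancel₀ (pow_ne_zero _ hq0), mul_one, mul_smul_comm]
  have hTX : T * X⁻¹ = X⁻¹ * T' := by
    rw [← one_mul (T * X⁻¹), ← hX2, mul_assoc, ← mul_assoc X, hXT, mul_assoc T', hX1, mul_one]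
  have hTZ' : Commute T' Z := Commute.sum_left _ _ _ fun n _ =>
    (((Commute.refl Z).pow_left 2).pow_left _).smul_left _
  have hTZi' : T' * Z⁻¹ = Z⁻¹ * T' := by
    rw [← one_mul (T' * Z⁻¹), ← hZ2, mul_assoc, ← mul_assoc Z, ← hTZ'.eq, mul_assoc T', hZ1, mul_one]
  have hZZ : Z⁻¹ * Z ^ 2 = Z := by rw [pow_two, ← mul_assoc, hZ2, one_mul]
  have key' : ys • (Z⁻¹ * T') - (μr * μs * xr) • (Z * T') =
      yr • (Z⁻¹ * T) - (μr * μs * xs) • (Z * T) := by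
    have := congrArg (Z⁻¹ * ·) key
    simpa [sub_mul, mul_sub, ← mul_assoc, hZZ] using this
  simp only [kronecker_one_eq_tensorBlock, bra_eq_tensorBlock, tensorBlock_mul, zero_mul, mul_zero,
    add_zero, zero_add]
  congr 1
  · simp only [mul_add, add_mul, mul_smul_comm, smul_mul_assoc, hXZ, hXZi, hTZ.eq, hTZi, smul_smul]
    module
  · rw [← mul_assoc T, hTX, mul_assoc X⁻¹, mul_assoc X⁻¹]
    congr 1
    simp only [mul_add, add_mul, mul_smul_comm, smul_mul_assoc, hTZ'.eq, hTZi']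
    linear_combination (norm := module) (z * κ₀) • key'
  · rw [mul_assoc _ X T, hXT, ← mul_assoc T, ← mul_assoc _ T' X]
    congr 1
    simp only [mul_add, add_mul, mul_smul_comm, smul_mul_assoc, hTZ.eq, hTZi]
    linear_combination (norm := module) (z * q * κ₁) • key'
  · simp only [mul_add, add_mul, mul_smul_comm, smul_mul_assoc, hTZ.eq, hTZi]
    module

end
end

section
/- Let N ≥ 3 be odd, q ∈ ℂ a primitive N-th root of unity, and let X, Z be invertible N×N complex matrices with Z·X = q·X·Z and X^N = Z^N = 1. On ℂ^N ⊗ ℂ^N set X₁ := X ⊗ 1, X₂ := 1 ⊗ X, Z₁ := Z ⊗ 1, Z₂ := 1 ⊗ Z, χ := X⁻¹ ⊗ X, and 𝒪 := ∑_{n=0}^{N-1} q^{-n²} χ^n. For 2×2 complex matrices A, B and i ∈ {1,2} let {A,B}ᵢ := diag(Xᵢ⁻¹,1)·A·diag(Zᵢ⁻¹,Zᵢ)·B·diag(Xᵢ,1), a 2×2 block matrix with blocks in End(ℂ^N ⊗ ℂ^N). Then for ALL 2×2 complex matrices A, B, C: diag(𝒪,𝒪)·{A,B}₁·{1₂,C}₂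 = {A,1₂}₁·{B,C}₂·diag(𝒪,𝒪). -/
open Matrix Kronecker

noncomputable section

section Helpers

/-- The truncated theta series `∑ q^{-n²} sⁿ cⁿ`, with `O(χ) = truncTheta N q χ 1`. -/
def truncTheta {R : Type*} [Ring R] [Algebra ℂ R] (N : ℕ) (q : ℂ) (c : R) (s : ℂ) : R :=
  ∑ n ∈ Finset.range N, (q ^ (-((n : ℤ) ^ 2)) * s ^ n) • c ^ n

variable {R : Type*} [Ring R] [Algebra ℂ R]

theorem pow_mul_of_mul_eq_smul {c y : R} {s : ℂ} (h : c * y = s • (y * c)) (n : ℕ) :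
    c ^ n * y = s ^ n • (y * c ^ n) := by
  induction n with
  | zero => simp
  | succ n ih =>
    rw [pow_succ, mul_assoc, h, mul_smul_comm, ← mul_assoc, ih, smul_mul_assoc, smul_smul,
      mul_assoc, ← pow_succ, pow_succ' s]

theorem truncTheta_mul {c y : R} {s : ℂ} (h : c * y = s • (y * c)) (N : ℕ) (q t : ℂ) :
    truncTheta N q c t * y = y * truncTheta N q c (t * s) := by
  simp only [truncTheta, Finset.sum_mul, Finset.mul_sum]
  refine Finset.sum_congr rfl fun n _ => ?_
  rw [smul_mul_assoc, pow_mul_of_mul_eq_smul h, smul_smul, mul_smul_comm, mul_pow, mul_assoc]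

/-- The functional equation `c · O(q⁻¹c) = O(qc)`. -/
theorem mul_truncTheta_inv {N : ℕ} {q : ℂ} (hq0 : q ≠ 0) (hqN : q ^ N = 1) {c : R}
    (hc : c ^ N = 1) : c * truncTheta N q c q⁻¹ = truncTheta N q c q := by
  set f : ℕ → R := fun n => (q ^ (-((n : ℤ) ^ 2)) * q ^ n) • c ^ n with hf
  have hfN : f N = f 0 := by
    have : q ^ (-((N : ℤ) ^ 2)) = 1 := by
      rw [_root_.zpow_neg, sq, _root_.zpow_mul, zpow_natCast, zpow_natCast, hqN, one_pow, inv_one]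
    simp only [hf, this, hqN, hc]
    simp
  have hsum : ∑ n ∈ Finset.range N, f (n + 1) = ∑ n ∈ Finset.range N, f n := by
    have := Finset.sum_range_succ' f N
    rw [Finset.sum_range_succ, hfN] at this
    exact (add_right_cancel this).symm
  rw [truncTheta, truncTheta, ← hf, ← hsum, Finset.mul_sum]
  refine Finset.sum_congr rfl fun n _ => ?_
  rw [mul_smul_comm, ← pow_succ']
  simp only [hf]
  congr 1
  rw [← zpow_natCast, ← zpow_natCast, _root_.inv_zpow', ← zpow_add₀ hq0, ← zpow_add₀ hq0]
  congr 1
  push_cast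
  ring

theorem mul_inv_eq_smul {m : Type*} [Fintype m] [DecidableEq m] {c y : Matrix m m ℂ} {s : ℂ}
    (hs : s ≠ 0) (hy : IsUnit y) (h : c * y = s • (y * c)) : c * y⁻¹ = s⁻¹ • (y⁻¹ * c) := by
  have hd := (Matrix.isUnit_iff_isUnit_det y).1 hy
  calc c * y⁻¹ = s⁻¹ • (y⁻¹ * (s • (y * c)) * y⁻¹) := by
        rw [mul_smul_comm, smul_mul_assoc, smul_smul, inv_mul_cancel₀ hs, one_smul,
          ← mul_assoc, Matrix.nonsing_inv_mul _ hd, one_mul]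
    _ = s⁻¹ • (y⁻¹ * c) := by
        rw [← h, mul_assoc, mul_assoc, Matrix.mul_nonsing_inv _ hd, mul_one]

theorem E00_mul_E00 : E00 * E00 = E00 := by
  ext i j
  fin_cases i <;> fin_cases j <;> simp [E00, Matrix.mul_apply]

theorem E11_mul_E11 : E11 * E11 = E11 := by
  ext i j
  fin_cases i <;> fin_cases j <;> simp [E11, Matrix.mul_apply]

theorem E00_mul_E11 : E00 * E11 = 0 := by
  ext i j
  fin_cases i <;> fin_cases j <;> simp [E00, E11, Matrix.mul_apply]

theorem E11_mul_E00 : E11 * E00 = 0 := by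
  ext i j
  fin_cases i <;> fin_cases j <;> simp [E00, E11, Matrix.mul_apply]

section Diagonal

variable {m : Type*}

/-- The block-diagonal operator `diag(a, b)`. -/
def blockDiag2 (a b : Matrix m m ℂ) : Matrix (m × Fin 2) (m × Fin 2) ℂ :=
  a ⊗ₖ E00 + b ⊗ₖ E11

theorem blockDiag2_self (a : Matrix m m ℂ) :
    blockDiag2 a a = a ⊗ₖ (1 : Matrix (Fin 2) (Fin 2) ℂ) := by
  rw [blockDiag2, ← Matrix.kronecker_add]
  congr 1
  ext i j
  fin_cases i <;> fin_cases j <;> simp [E00, E11]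

variable [Fintype m] [DecidableEq m]

theorem blockDiag2_mul (a b c d : Matrix m m ℂ) :
    blockDiag2 a b * blockDiag2 c d = blockDiag2 (a * c) (b * d) := by
  simp [blockDiag2, add_mul, mul_add, ← Matrix.mul_kronecker_mul, E00_mul_E00, E11_mul_E11,
    E00_mul_E11, E11_mul_E00]

theorem kronecker_one_comm (a : Matrix m m ℂ) (B : Matrix (Fin 2) (Fin 2) ℂ) :
    blockDiag2 a a * ((1 : Matrix m m ℂ) ⊗ₖ B) = ((1 : Matrix m m ℂ) ⊗ₖ B) * blockDiag2 a a := by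
  simp [blockDiag2_self, ← Matrix.mul_kronecker_mul]

theorem bra_eq (X Z : Matrix m m ℂ) (A B : Matrix (Fin 2) (Fin 2) ℂ) :
    bra X Z A B = blockDiag2 X⁻¹ 1 * ((1 : Matrix m m ℂ) ⊗ₖ A) * blockDiag2 Z⁻¹ Z *
      ((1 : Matrix m m ℂ) ⊗ₖ B) * blockDiag2 X 1 := rfl

theorem blockDiag2_sandwich {a b c d a' b' c' d' : Matrix m m ℂ} (B : Matrix (Fin 2) (Fin 2) ℂ)
    (h00 : a * c = a' * c') (h01 : a * d = a' * d') (h10 : b * c = b' * c')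
    (h11 : b * d = b' * d') :
    blockDiag2 a b * ((1 : Matrix m m ℂ) ⊗ₖ B) * blockDiag2 c d =
      blockDiag2 a' b' * ((1 : Matrix m m ℂ) ⊗ₖ B) * blockDiag2 c' d' := by
  simp [blockDiag2, add_mul, mul_add, ← Matrix.mul_kronecker_mul, h00, h01, h10, h11]

theorem bra_factorization {O X₁ X₂ Z₁ Z₂ : Matrix m m ℂ} (hO₁ : O * X₁⁻¹ = X₁⁻¹ * O)
    (hO₂ : O * X₂ = X₂ * O)
    (h00 : O * Z₁⁻¹ * (X₁ * X₂⁻¹ * Z₂⁻¹) = Z₁⁻¹ * (X₁ * X₂⁻¹) * (Z₂⁻¹ * O))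
    (h01 : O * Z₁⁻¹ * Z₂ = Z₁⁻¹ * (X₁ * X₂⁻¹) * (Z₂ * O))
    (h10 : O * Z₁ * (X₁ * X₂⁻¹ * Z₂⁻¹) = Z₁ * (Z₂⁻¹ * O))
    (h11 : O * Z₁ * Z₂ = Z₁ * (Z₂ * O)) (A B C : Matrix (Fin 2) (Fin 2) ℂ) :
    (O ⊗ₖ (1 : Matrix (Fin 2) (Fin 2) ℂ)) * bra X₁ Z₁ A B * bra X₂ Z₂ 1 C =
      bra X₁ Z₁ A 1 * bra X₂ Z₂ B C * (O ⊗ₖ (1 : Matrix (Fin 2) (Fin 2) ℂ)) := by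
  have key := blockDiag2_sandwich B h00 h01 h10 h11
  have hA := kronecker_one_comm O A
  have hC := kronecker_one_comm O C
  have hX₁ : blockDiag2 O O * blockDiag2 X₁⁻¹ 1 = blockDiag2 X₁⁻¹ 1 * blockDiag2 O O := by
    simp [blockDiag2_mul, hO₁]
  have hX₂ : blockDiag2 O O * blockDiag2 X₂ 1 = blockDiag2 X₂ 1 * blockDiag2 O O := by
    simp [blockDiag2_mul, hO₂]
  have hl : blockDiag2 (X₁ * X₂⁻¹ * Z₂⁻¹) Z₂ =
      blockDiag2 X₁ 1 * blockDiag2 X₂⁻¹ 1 * blockDiag2 Z₂⁻¹ Z₂ := by simp [blockDiag2_mul]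
  have hr : blockDiag2 (Z₁⁻¹ * (X₁ * X₂⁻¹)) Z₁ =
      blockDiag2 Z₁⁻¹ Z₁ * (blockDiag2 X₁ 1 * blockDiag2 X₂⁻¹ 1) := by simp [blockDiag2_mul]
  rw [hl, hr, ← blockDiag2_mul, ← blockDiag2_mul] at key
  rw [← blockDiag2_self, bra_eq, bra_eq, bra_eq, bra_eq, Matrix.one_kronecker_one]
  generalize blockDiag2 O O = P at *
  generalize (1 : Matrix m m ℂ) ⊗ₖ A = A' at *
  generalize (1 : Matrix m m ℂ) ⊗ₖ B = B' at *
  generalize (1 : Matrix m m ℂ) ⊗ₖ C = C' at *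
  generalize blockDiag2 X₁⁻¹ 1 = U at *
  generalize blockDiag2 X₂ 1 = V at *
  generalize blockDiag2 Z₁⁻¹ Z₁ = D₁ at *
  generalize blockDiag2 Z₂⁻¹ Z₂ = D₂ at *
  generalize blockDiag2 X₁ 1 = K at *
  generalize blockDiag2 X₂⁻¹ 1 = L at *
  simp only [mul_one]
  calc P * (U * A' * D₁ * B' * K) * (L * D₂ * C' * V)
      = (P * U) * A' * D₁ * B' * K * L * D₂ * C' * V := by simp only [mul_assoc]
    _ = U * (P * A') * D₁ * B' * K * L * D₂ * C' * V := by rw [hX₁]; simp only [mul_assoc]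
    _ = U * A' * (P * D₁ * B' * (K * L * D₂)) * C' * V := by rw [hA]; simp only [mul_assoc]
    _ = U * A' * D₁ * K * L * B' * D₂ * (P * C') * V := by rw [key]; simp only [mul_assoc]
    _ = U * A' * D₁ * K * L * B' * D₂ * C' * (P * V) := by rw [hC]; simp only [mul_assoc]
    _ = _ := by rw [hX₂]; simp only [mul_assoc]

end Diagonal

end Helpers

/-- The key factorization identity (eq:ABC) underlying the factorization of L-operators:
`𝒪(χ)·{A,B}₁·{1,C}₂ = {A,1}₁·{B,C}₂·𝒪(χ)` for all 2×2 matrices `A`, `B`, `C`. -/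
theorem stmt_13 (N : ℕ) (hN : 3 ≤ N) (hNodd : Odd N)
    (q : ℂ) (hq : IsPrimitiveRoot q N)
    (X Z : Matrix (Fin N) (Fin N) ℂ) (hXu : IsUnit X) (hZu : IsUnit Z)
    (hZX : Z * X = q • (X * Z)) (hXN : X ^ N = 1) (hZN : Z ^ N = 1) :
    ∀ A B C : Matrix (Fin 2) (Fin 2) ℂ,
      ((∑ n ∈ Finset.range N, q ^ (-((n : ℤ) ^ 2)) • (X⁻¹ ⊗ₖ X) ^ n) ⊗ₖ
          (1 : Matrix (Fin 2) (Fin 2) ℂ)) *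
          bra (X ⊗ₖ (1 : Matrix (Fin N) (Fin N) ℂ))
            (Z ⊗ₖ (1 : Matrix (Fin N) (Fin N) ℂ)) A B *
          bra ((1 : Matrix (Fin N) (Fin N) ℂ) ⊗ₖ X)
            ((1 : Matrix (Fin N) (Fin N) ℂ) ⊗ₖ Z) 1 C
        = bra (X ⊗ₖ (1 : Matrix (Fin N) (Fin N) ℂ))
            (Z ⊗ₖ (1 : Matrix (Fin N) (Fin N) ℂ)) A 1 *
          bra ((1 : Matrix (Fin N) (Fin N) ℂ) ⊗ₖ X)
            ((1 : Matrix (Fin N) (Fin N) ℂ) ⊗ₖ Z) B C *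
          ((∑ n ∈ Finset.range N, q ^ (-((n : ℤ) ^ 2)) • (X⁻¹ ⊗ₖ X) ^ n) ⊗ₖ
            (1 : Matrix (Fin 2) (Fin 2) ℂ)) := by
  intro A B C
  have hq0 : q ≠ 0 := hq.ne_zero (by omega)
  have hqN : q ^ N = 1 := hq.pow_eq_one
  have hXd := (Matrix.isUnit_iff_isUnit_det X).1 hXu
  have hZd := (Matrix.isUnit_iff_isUnit_det Z).1 hZu
  have hXX : X * X⁻¹ = 1 := Matrix.mul_nonsing_inv _ hXd
  have hXX' : X⁻¹ * X = 1 := Matrix.nonsing_inv_mul _ hXd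
  have hXinvN : X⁻¹ ^ N = 1 := by rw [Matrix.inv_pow', hXN, inv_one]
  have hXZ : X * Z = q⁻¹ • (Z * X) := by rw [hZX, smul_smul, inv_mul_cancel₀ hq0, one_smul]
  have hXiZ : X⁻¹ * Z = q • (Z * X⁻¹) := by
    have := mul_inv_eq_smul hq0 hXu hZX
    rw [this, smul_smul, mul_inv_cancel₀ hq0, one_smul]
  have hZ₁u : IsUnit (Z ⊗ₖ (1 : Matrix (Fin N) (Fin N) ℂ)) := by
    rw [Matrix.isUnit_iff_isUnit_det, Matrix.det_kronecker]
    simpa using hZd.pow _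
  have hZ₂u : IsUnit ((1 : Matrix (Fin N) (Fin N) ℂ) ⊗ₖ Z) := by
    rw [Matrix.isUnit_iff_isUnit_det, Matrix.det_kronecker]
    simpa using hZd.pow _
  have hχpow : ∀ n : ℕ, (X⁻¹ ⊗ₖ X) ^ n = (X⁻¹ ^ n) ⊗ₖ (X ^ n) := by
    intro n
    induction n with
    | zero => simp
    | succ n ih => rw [pow_succ, ih, ← Matrix.mul_kronecker_mul, ← pow_succ, ← pow_succ]
  have hχN : (X⁻¹ ⊗ₖ X) ^ N = 1 := by rw [hχpow, hXinvN, hXN, Matrix.one_kronecker_one]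
  have hO : (∑ n ∈ Finset.range N, q ^ (-((n : ℤ) ^ 2)) • (X⁻¹ ⊗ₖ X) ^ n) =
      truncTheta N q (X⁻¹ ⊗ₖ X) 1 := by simp [truncTheta]
  have hZ₁ : (X⁻¹ ⊗ₖ X) * (Z ⊗ₖ (1 : Matrix (Fin N) (Fin N) ℂ)) =
      q • ((Z ⊗ₖ (1 : Matrix (Fin N) (Fin N) ℂ)) * (X⁻¹ ⊗ₖ X)) := by
    rw [← Matrix.mul_kronecker_mul, ← Matrix.mul_kronecker_mul, hXiZ, Matrix.smul_kronecker,
      mul_one, one_mul]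
  have hZ₂ : (X⁻¹ ⊗ₖ X) * ((1 : Matrix (Fin N) (Fin N) ℂ) ⊗ₖ Z) =
      q⁻¹ • (((1 : Matrix (Fin N) (Fin N) ℂ) ⊗ₖ Z) * (X⁻¹ ⊗ₖ X)) := by
    rw [← Matrix.mul_kronecker_mul, ← Matrix.mul_kronecker_mul, hXZ, Matrix.kronecker_smul,
      mul_one, one_mul]
  have hZ₁i := mul_inv_eq_smul hq0 hZ₁u hZ₁
  have hZ₂i := mul_inv_eq_smul (inv_ne_zero hq0) hZ₂u hZ₂
  rw [inv_inv] at hZ₂i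
  have hW : (X ⊗ₖ (1 : Matrix (Fin N) (Fin N) ℂ)) * ((1 : Matrix (Fin N) (Fin N) ℂ) ⊗ₖ X)⁻¹ =
      X ⊗ₖ X⁻¹ := by
    rw [Matrix.inv_kronecker, ← Matrix.mul_kronecker_mul, inv_one, one_mul, mul_one]
  have hWχ : (X ⊗ₖ X⁻¹) * (X⁻¹ ⊗ₖ X) = 1 := by
    rw [← Matrix.mul_kronecker_mul, hXX, hXX', Matrix.one_kronecker_one]
  have hχW : (X⁻¹ ⊗ₖ X) * (X ⊗ₖ X⁻¹) = 1 := by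
    rw [← Matrix.mul_kronecker_mul, hXX, hXX', Matrix.one_kronecker_one]
  have hX₁ : (X⁻¹ ⊗ₖ X) * (X ⊗ₖ (1 : Matrix (Fin N) (Fin N) ℂ))⁻¹ =
      (1 : ℂ) • ((X ⊗ₖ (1 : Matrix (Fin N) (Fin N) ℂ))⁻¹ * (X⁻¹ ⊗ₖ X)) := by
    rw [Matrix.inv_kronecker, ← Matrix.mul_kronecker_mul, ← Matrix.mul_kronecker_mul]
    simp
  have hX₂ : (X⁻¹ ⊗ₖ X) * ((1 : Matrix (Fin N) (Fin N) ℂ) ⊗ₖ X) =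
      (1 : ℂ) • (((1 : Matrix (Fin N) (Fin N) ℂ) ⊗ₖ X) * (X⁻¹ ⊗ₖ X)) := by
    rw [← Matrix.mul_kronecker_mul, ← Matrix.mul_kronecker_mul]
    simp
  have hshift := mul_truncTheta_inv hq0 hqN hχN
  have hθW : ∀ t : ℂ, truncTheta N q (X⁻¹ ⊗ₖ X) t * (X ⊗ₖ X⁻¹) =
      (X ⊗ₖ X⁻¹) * truncTheta N q (X⁻¹ ⊗ₖ X) t := by
    intro t
    have := truncTheta_mul (c := X⁻¹ ⊗ₖ X) (y := X ⊗ₖ X⁻¹) (s := 1)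
      (by rw [hWχ, hχW, one_smul]) N q t
    rwa [mul_one] at this
  have hshift' : (X ⊗ₖ X⁻¹) * truncTheta N q (X⁻¹ ⊗ₖ X) q = truncTheta N q (X⁻¹ ⊗ₖ X) q⁻¹ := by
    rw [← hshift, ← mul_assoc, hWχ, one_mul]
  have hθZ₁ := truncTheta_mul hZ₁ N q 1
  have hθZ₁i := truncTheta_mul hZ₁i N q 1
  have hθZ₂ := truncTheta_mul hZ₂ N q q
  have hθZ₂i := truncTheta_mul hZ₂i N q q⁻¹
  rw [one_mul] at hθZ₁ hθZ₁i
  rw [mul_inv_cancel₀ hq0] at hθZ₂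
  rw [inv_mul_cancel₀ hq0] at hθZ₂i
  rw [hO]
  apply bra_factorization
  · have := truncTheta_mul hX₁ N q 1
    rwa [mul_one] at this
  · have := truncTheta_mul hX₂ N q 1
    rwa [mul_one] at this
  · rw [hW, hθZ₁i, ← hθZ₂i, mul_assoc, ← mul_assoc (truncTheta _ _ _ _), hθW]
    simp only [mul_assoc]
  · rw [hW, hθZ₁i, ← hθZ₂, ← hshift']
    simp only [mul_assoc]
  · rw [hW, hθZ₁, ← hθZ₂i, mul_assoc, ← mul_assoc (truncTheta _ _ _ _), hθW, hshift']
  · rw [hθZ₁, ← hθZ₂, mul_assoc]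


end
end
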